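/- Let G be a simplicial group. Define H_n : Diag_n NG × Δ^1_n → Diag_n NG by ((g_{n,i})_{i=n−1,…,0}, τ^{n+1−k}) ↦ (y_i^{(n+1−k)})_{i=n−1,…,0}, where y_i^{(n+1−k)} = g_{n,i} for i ≥ k−1 and, by descending recursion, y_i^{(n+1−k)} = (∏_{j=i+1}^{k−2} (y_j^{(n+1−k)})^{−1} d_j⋯d_{i+1} s_i⋯s_{j−1}) (∏_{j=k−2}^{i} g_{n,j} d_{k−1}⋯d_{i+1} s_i⋯s_{k−2}) for i ≤ k−2. Then H is a simplicial map Diag NG × Δ^1 → Diag NG. -/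

import Mathlib

namespace Paper

/-- clamped coface map `δ^k : [a] → [b]`. -/
def δOH (k a b : ℕ) : Fin (a+1) →o Fin (b+1) where
  toFun i := ⟨min (if (i:ℕ) < k then (i:ℕ) else (i:ℕ)+1) b, Nat.lt_succ_of_le (Nat.min_le_right _ _)⟩
  monotone' := by
    intro i j hij
    have h : (i:ℕ) ≤ (j:ℕ) := hij
    simp only [Fin.mk_le_mk]
    split_ifs <;> omega

/-- clamped codegeneracy map `σ^k : [a] → [b]`. -/
def σOH (k a b : ℕ) : Fin (a+1) →o Fin (b+1) where
  toFun i := ⟨min (if (i:ℕ) ≤ k then (i:ℕ) else (i:ℕ)-1) b, Nat.lt_succ_of_le (Nat.min_le_right _ _)⟩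
  monotone' := by
    intro i j hij
    have h : (i:ℕ) ≤ (j:ℕ) := hij
    simp only [Fin.mk_le_mk]
    split_ifs <;> omega

/-- `τ^k : [n] → [1]`, sending `[0, n-k]` to `0` and the rest to `1`. -/
def τOH (n k : ℕ) : Fin (n+1) →o Fin 2 where
  toFun i := if (i:ℕ) + k ≤ n then 0 else 1
  monotone' := by
    intro i j hij
    have h : (i:ℕ) ≤ (j:ℕ) := hij
    dsimp only
    split_ifs with h1 h2 h3
    · exact le_refl _
    · exact Fin.zero_le _
    · exact absurd h3 (by omega)
    · exact le_refl _

/-- application of `θ : [m] → [n]` to a natural number (clamped). -/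
def fApp {m n : ℕ} (θ : Fin (m+1) →o Fin (n+1)) (x : ℕ) : ℕ :=
  (θ ⟨min x m, Nat.lt_succ_of_le (Nat.min_le_right _ _)⟩ : Fin (n+1))

theorem fApp_mono {m n : ℕ} (θ : Fin (m+1) →o Fin (n+1)) {x y : ℕ} (h : x ≤ y) :
    fApp θ x ≤ fApp θ y :=
  Fin.le_def.mp (θ.monotone (Fin.mk_le_mk.mpr (by omega)))

theorem fApp_le {m n : ℕ} (θ : Fin (m+1) →o Fin (n+1)) (x : ℕ) : fApp θ x ≤ n :=
  Nat.lt_succ_iff.mp (Fin.isLt _)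

theorem fApp_coe {m n : ℕ} (θ : Fin (m+1) →o Fin (n+1)) (p : Fin (m+1)) :
    fApp θ (p:ℕ) = (θ p : ℕ) := by
  have hp : (⟨min (p:ℕ) m, Nat.lt_succ_of_le (Nat.min_le_right _ _)⟩ : Fin (m+1)) = p :=
    Fin.ext (show min (p:ℕ) m = (p:ℕ) from by have := p.isLt; omega)
  unfold fApp
  rw [hp]

/-- `Spl_{≤ p}(θ) : [p] → [pθ]`. -/
def splLe {m n : ℕ} (θ : Fin (m+1) →o Fin (n+1)) (p : Fin (m+1)) :
    Fin ((p:ℕ)+1) →o Fin ((θ p : ℕ)+1) where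
  toFun i := ⟨fApp θ (i:ℕ), by
    have h1 : fApp θ (i:ℕ) ≤ fApp θ (p:ℕ) := fApp_mono θ (by have := i.isLt; omega)
    have h2 : fApp θ (p:ℕ) = (θ p : ℕ) := fApp_coe θ p
    omega⟩
  monotone' := by
    intro a b hab
    have h : (a:ℕ) ≤ (b:ℕ) := hab
    simp only [Fin.mk_le_mk]
    exact fApp_mono θ h

/-- `Spl_{≥ p}(θ) : [m-p] → [n-pθ]`. -/
def splGe {m n : ℕ} (θ : Fin (m+1) →o Fin (n+1)) (p : Fin (m+1)) :
    Fin (m - (p:ℕ) + 1) →o Fin (n - (θ p : ℕ) + 1) where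
  toFun i := ⟨fApp θ ((i:ℕ) + (p:ℕ)) - (θ p : ℕ), by
    have h1 : fApp θ ((i:ℕ) + (p:ℕ)) ≤ n := fApp_le θ _
    omega⟩
  monotone' := by
    intro a b hab
    have h : (a:ℕ) ≤ (b:ℕ) := hab
    simp only [Fin.mk_le_mk]
    have := fApp_mono θ (show (a:ℕ) + (p:ℕ) ≤ (b:ℕ) + (p:ℕ) by omega)
    omega

/-- the restriction `θ|_[i]^[j] : [i] → [j]` of `θ` (clamped). -/
def restrictOH {m n : ℕ} (θ : Fin (m+1) →o Fin (n+1)) (i j : ℕ) : Fin (i+1) →o Fin (j+1) where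
  toFun k := ⟨min (fApp θ (k:ℕ)) j, Nat.lt_succ_of_le (Nat.min_le_right _ _)⟩
  monotone' := by
    intro a b hab
    have h : (a:ℕ) ≤ (b:ℕ) := hab
    simp only [Fin.mk_le_mk]
    have := fApp_mono θ h
    omega

/-- ascending product `f a * f (a+1) * ⋯ * f (b-1)`. -/
def aProd {γ : Type*} [Monoid γ] (f : ℕ → γ) (a : ℕ) : ℕ → γ
  | 0 => 1
  | b+1 => if a ≤ b then aProd f a b * f b else 1

/-- descending product `f (b-1) * f (b-2) * ⋯ * f a`. -/
def dProd {γ : Type*} [Monoid γ] (f : ℕ → γ) (a : ℕ) : ℕ → γ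
  | 0 => 1
  | b+1 => if a ≤ b then f b * dProd f a b else 1

end Paper
namespace Paper

/-- A simplicial group, given by levels, structure maps, functoriality,
and levelwise multiplicativity. -/
structure SGrp where
  obj : ℕ → Type
  grp : ∀ n, Group (obj n)
  map : ∀ {m n : ℕ}, (Fin (m+1) →o Fin (n+1)) → obj n → obj m
  map_id : ∀ {n : ℕ} (x : obj n), map OrderHom.id x = x
  map_comp : ∀ {l m n : ℕ} (α : Fin (l+1) →o Fin (m+1)) (β : Fin (m+1) →o Fin (n+1)) (x : obj n),
    map α (map β x) = map (β.comp α) x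
  map_mul : ∀ {m n : ℕ} (θ : Fin (m+1) →o Fin (n+1)) (x y : obj n),
    map θ (x * y) = map θ x * map θ y

attribute [instance] SGrp.grp

namespace SGrp

/-- face `d_k : G_N → G_{N-1}` -/
def face (G : SGrp) (k : ℕ) {N : ℕ} : G.obj N → G.obj (N-1) := G.map (δOH k (N-1) N)

/-- degeneracy `s_k : G_M → G_{M+1}` -/
def deg (G : SGrp) (k : ℕ) {M : ℕ} : G.obj M → G.obj (M+1) := G.map (σOH k (M+1) M)

/-- transport between levels (junk value `1` when levels differ). -/
def gcast (G : SGrp) {a : ℕ} (b : ℕ) (x : G.obj a) : G.obj b := if h : a = b then h ▸ x else 1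

/-- descending composite of faces `d_{i+c} d_{i+c-1} ⋯ d_{i+1}`. -/
def dcomp (G : SGrp) : (i c : ℕ) → {N : ℕ} → G.obj N → G.obj (N - c)
  | _, 0, _, x => x
  | i, c+1, _, x => G.face (i+1) (G.dcomp (i+1) c x)

/-- ascending composite of degeneracies `s_i s_{i+1} ⋯ s_{i+c-1}`. -/
def scomp (G : SGrp) : (i c : ℕ) → {M : ℕ} → G.obj M → G.obj (M + c)
  | _, 0, _, x => x
  | i, c+1, _, x => G.deg (i+c) (G.scomp i c x)

/-- `x ↦ x d_j ⋯ d_{i+1} s_i ⋯ s_{j-1}`, an endomap of `G_N`. -/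
def ds (G : SGrp) (i j : ℕ) {N : ℕ} (x : G.obj N) : G.obj N :=
  G.gcast N (G.scomp i (min (j - i) N) (G.dcomp i (min (j - i) N) x))

/-- `x ↦ x d_j ⋯ d_{i+1} s_i ⋯ s_{n-1} : G_j → G_n`. -/
def dsTo (G : SGrp) (i n : ℕ) {j : ℕ} (x : G.obj j) : G.obj n :=
  G.gcast n (G.scomp i (n - i) (G.gcast i (G.dcomp i (j - i) x)))

/-- the `y_i` of the section `S_G`, defined by descending recursion (with fuel). -/
def yAux (G : SGrp) (n : ℕ) (g : ∀ j : ℕ, G.obj j) : ℕ → ℕ → G.obj n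
  | 0, _ => 1
  | fuel+1, i =>
      aProd (fun j => G.ds i j (G.yAux n g fuel j)⁻¹) (i+1) n *
      dProd (fun j => G.dsTo i n (g j)) i n

/-- `W̄_n G = ∏_{j = n-1}^{0} G_j`. -/
def WbarN (G : SGrp) (n : ℕ) : Type := ∀ j : Fin n, G.obj (j:ℕ)

/-- extension of a tuple in `W̄_n G` by `1`. -/
def gE (G : SGrp) {n : ℕ} (g : G.WbarN n) : ∀ j : ℕ, G.obj j :=
  fun j => if h : j < n then g ⟨j, h⟩ else 1

/-- the coretraction `(S_G)_n : W̄_n G → Diag_n NG = (G_n)^n`. -/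
def SGn (G : SGrp) (n : ℕ) (g : G.WbarN n) : Fin n → G.obj n :=
  fun i => G.yAux n (G.gE g) n (i:ℕ)

/-- extension of a tuple in `(G_n)^n` by `1`. -/
def xE (G : SGrp) {n : ℕ} (x : Fin n → G.obj n) : ℕ → G.obj n :=
  fun j => if h : j < n then x ⟨j, h⟩ else 1

/-- the structure map `W̄_θ : W̄_n G → W̄_m G` of the Kan classifying simplicial set. -/
def wbarMap (G : SGrp) {m n : ℕ} (θ : Fin (m+1) →o Fin (n+1)) (g : G.WbarN n) : G.WbarN m :=
  fun i => dProd (fun j => G.map (restrictOH θ (i:ℕ) j) (G.gE g j))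
    ((θ i.castSucc : Fin (n+1)) : ℕ) ((θ i.succ : Fin (n+1)) : ℕ)

/-- the structure map `(Diag NG)_θ : (G_n)^n → (G_m)^m` of the diagonal of the nerve. -/
def diagMap (G : SGrp) {m n : ℕ} (θ : Fin (m+1) →o Fin (n+1)) (x : Fin n → G.obj n) :
    Fin m → G.obj m :=
  fun i => dProd (fun j => G.map θ (G.xE x j))
    ((θ i.castSucc : Fin (n+1)) : ℕ) ((θ i.succ : Fin (n+1)) : ℕ)

/-- the retraction `(D_G)_n : Diag_n NG → W̄_n G`, `(g_i)_i ↦ (g_i d_n ⋯ d_{i+1})_i`. -/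
def DGn (G : SGrp) (n : ℕ) (x : Fin n → G.obj n) : G.WbarN n :=
  fun i => G.gcast (i:ℕ) (G.dcomp (i:ℕ) (n - (i:ℕ)) (x i))

/-- the components `y_i^{(n+1-k)}` of the homotopy `H`, by descending recursion (with fuel). -/
def hAux (G : SGrp) (n k : ℕ) (g : ℕ → G.obj n) : ℕ → ℕ → G.obj n
  | 0, _ => 1
  | fuel+1, i =>
      if k ≤ i + 1 then g i
      else
        aProd (fun j => G.ds i j (G.hAux n k g fuel j)⁻¹) (i+1) (k-1) *
        dProd (fun j => G.ds i (k-1) (g j)) i (k-1)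

end SGrp

/-- recover `k` from the simplex `τ^{n+1-k} ∈ Δ^1_n`: the number of vertices sent to `0`. -/
def kOf {n : ℕ} (t : Fin (n+1) →o Fin 2) : ℕ :=
  (Finset.univ.filter (fun i => t i = 0)).card

namespace SGrp

/-- the homotopy `H_n : Diag_n NG × Δ^1_n → Diag_n NG`. -/
def Hn (G : SGrp) (n : ℕ) (x : Fin n → G.obj n) (t : Fin (n+1) →o Fin 2) : Fin n → G.obj n :=
  fun i => G.hAux n (kOf t) (G.xE x) (n+1) (i:ℕ)

end SGrp

/-- morphisms of simplicial groups. -/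
structure SGrpHom (G G' : SGrp) where
  app : ∀ n, G.obj n → G'.obj n
  comm : ∀ {m n : ℕ} (θ : Fin (m+1) →o Fin (n+1)) (x : G.obj n),
    app m (G.map θ x) = G'.map θ (app n x)
  mul : ∀ (n : ℕ) (x y : G.obj n), app n (x * y) = app n x * app n y

end Paper
namespace Paper

section Products

variable {γ δ : Type*}

theorem dProd_of_le [Monoid γ] (f : ℕ → γ) {a b : ℕ} (h : b ≤ a) : dProd f a b = 1 := by
  cases b with
  | zero => rfl
  | succ b => simp [dProd, show ¬ a ≤ b by omega]

theorem dProd_succ_top [Monoid γ] (f : ℕ → γ) {a b : ℕ} (h : a ≤ b) :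
    dProd f a (b + 1) = f b * dProd f a b := by
  simp [dProd, h]

theorem dProd_congr [Monoid γ] {f g : ℕ → γ} {a b : ℕ}
    (h : ∀ j, a ≤ j → j < b → f j = g j) : dProd f a b = dProd g a b := by
  induction b with
  | zero => rfl
  | succ b ih =>
    by_cases hab : a ≤ b
    · rw [dProd_succ_top f hab, dProd_succ_top g hab, h b hab (by omega),
        ih fun j h1 h2 => h j h1 (by omega)]
    · rw [dProd_of_le f (by omega), dProd_of_le g (by omega)]

theorem dProd_mul_dProd [Monoid γ] (f : ℕ → γ) {a b c : ℕ} (hab : a ≤ b) (hbc : b ≤ c) :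
    dProd f b c * dProd f a b = dProd f a c := by
  induction c, hbc using Nat.le_induction with
  | base => rw [dProd_of_le f le_rfl, one_mul]
  | succ c hbc ih =>
    rw [dProd_succ_top f hbc, dProd_succ_top f (hab.trans hbc), mul_assoc, ih]

theorem dProd_eq_mul_bottom [Monoid γ] (f : ℕ → γ) {a b : ℕ} (h : a < b) :
    dProd f a b = dProd f (a + 1) b * f a := by
  rw [← dProd_mul_dProd f (Nat.le_succ a) h, Nat.succ_eq_add_one, dProd_succ_top f le_rfl,
    dProd_of_le f le_rfl, mul_one]

theorem map_dProd [Monoid γ] [Monoid δ] (φ : γ →* δ) (f : ℕ → γ) (a b : ℕ) :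
    φ (dProd f a b) = dProd (fun j => φ (f j)) a b := by
  induction b with
  | zero => exact map_one φ
  | succ b ih =>
    by_cases hab : a ≤ b
    · rw [dProd_succ_top _ hab, dProd_succ_top _ hab, map_mul, ih]
    · rw [dProd_of_le _ (by omega), dProd_of_le _ (by omega), map_one]

theorem dProd_dProd [Monoid γ] (f : ℕ → γ) {T : ℕ → ℕ} (hT : Monotone T) {a b : ℕ}
    (h : a ≤ b) : dProd (fun j => dProd f (T j) (T (j + 1))) a b = dProd f (T a) (T b) := by
  induction b, h using Nat.le_induction with
  | base => rw [dProd_of_le _ le_rfl, dProd_of_le _ le_rfl]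
  | succ b h ih =>
    rw [dProd_succ_top _ h, ih, dProd_mul_dProd f (hT h) (hT (Nat.le_succ b))]

theorem aProd_inv [Group γ] (f : ℕ → γ) (a b : ℕ) :
    aProd (fun j => (f j)⁻¹) a b = (dProd f a b)⁻¹ := by
  induction b with
  | zero => simp [aProd, dProd]
  | succ b ih =>
    by_cases hab : a ≤ b
    · simp [aProd, dProd, hab, ih]
    · simp [aProd, dProd, hab]

theorem aProd_congr [Monoid γ] {f g : ℕ → γ} {a b : ℕ}
    (h : ∀ j, a ≤ j → j < b → f j = g j) : aProd f a b = aProd g a b := by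
  induction b with
  | zero => rfl
  | succ b ih =>
    by_cases hab : a ≤ b
    · simp only [aProd, if_pos hab]
      rw [h b hab (by omega), ih fun j h1 h2 => h j h1 (by omega)]
    · simp [aProd, hab]

end Products

/-- The monotone endomap of `[N]` collapsing `{i, …, j}` to `i` and fixing everything else. -/
def collapseOH (N i j : ℕ) : Fin (N+1) →o Fin (N+1) where
  toFun p := ⟨if i ≤ (p:ℕ) ∧ (p:ℕ) ≤ j then i else p, by split_ifs <;> omega⟩
  monotone' := by
    intro a b hab
    have h : (a:ℕ) ≤ (b:ℕ) := hab
    simp only [Fin.mk_le_mk]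
    split_ifs <;> omega

/-- The composite of `c` cofaces skipping `i+1, …, i+c` (clamped). -/
def skipOH (i c a b : ℕ) : Fin (a+1) →o Fin (b+1) where
  toFun p := ⟨min (if (p:ℕ) ≤ i then p else p + c) b,
    Nat.lt_succ_of_le (Nat.min_le_right _ _)⟩
  monotone' := by
    intro a b hab
    have h : (a:ℕ) ≤ (b:ℕ) := hab
    simp only [Fin.mk_le_mk]
    split_ifs <;> omega

/-- The composite of `c` codegeneracies collapsing `i, …, i+c` (clamped). -/
def squashOH (i c a b : ℕ) : Fin (a+1) →o Fin (b+1) where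
  toFun p := ⟨min (if (p:ℕ) ≤ i then p else if (p:ℕ) ≤ i + c then i else p - c) b,
    Nat.lt_succ_of_le (Nat.min_le_right _ _)⟩
  monotone' := by
    intro a b hab
    have h : (a:ℕ) ≤ (b:ℕ) := hab
    simp only [Fin.mk_le_mk]
    split_ifs <;> omega

theorem δOH_val (k a b : ℕ) (p : Fin (a+1)) :
    (δOH k a b p : ℕ) = min (if (p:ℕ) < k then (p:ℕ) else (p:ℕ)+1) b := rfl

theorem σOH_val (k a b : ℕ) (p : Fin (a+1)) :
    (σOH k a b p : ℕ) = min (if (p:ℕ) ≤ k then (p:ℕ) else (p:ℕ)-1) b := rfl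

theorem collapseOH_val (N i j : ℕ) (p : Fin (N+1)) :
    (collapseOH N i j p : ℕ) = if i ≤ (p:ℕ) ∧ (p:ℕ) ≤ j then i else (p:ℕ) := rfl

theorem skipOH_val (i c a b : ℕ) (p : Fin (a+1)) :
    (skipOH i c a b p : ℕ) = min (if (p:ℕ) ≤ i then (p:ℕ) else p + c) b := rfl

theorem squashOH_val (i c a b : ℕ) (p : Fin (a+1)) :
    (squashOH i c a b p : ℕ) =
      min (if (p:ℕ) ≤ i then (p:ℕ) else if (p:ℕ) ≤ i + c then i else p - c) b := rfl

namespace SGrp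

variable (G : SGrp)

/-- The structure map of a simplicial group as a group homomorphism. -/
def mapHom {m n : ℕ} (θ : Fin (m+1) →o Fin (n+1)) : G.obj n →* G.obj m :=
  MonoidHom.mk' (G.map θ) (G.map_mul θ)

theorem map_inv {m n : ℕ} (θ : Fin (m+1) →o Fin (n+1)) (x : G.obj n) :
    G.map θ x⁻¹ = (G.map θ x)⁻¹ :=
  _root_.map_inv (G.mapHom θ) x

theorem map_dProd {m n : ℕ} (θ : Fin (m+1) →o Fin (n+1)) (f : ℕ → G.obj n) (a b : ℕ) :
    G.map θ (dProd f a b) = dProd (fun j => G.map θ (f j)) a b :=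
  Paper.map_dProd (G.mapHom θ) f a b

theorem dcomp_eq_map {N : ℕ} (i c : ℕ) (h : i + c ≤ N) (x : G.obj N) :
    G.dcomp i c x = G.map (skipOH i c (N - c) N) x := by
  induction c generalizing i with
  | zero =>
    conv_lhs => rw [dcomp, ← G.map_id x]
    congr 1
    ext p
    have := p.isLt
    simp only [skipOH_val, OrderHom.id_coe, id]
    split_ifs <;> omega
  | succ c ih =>
    rw [dcomp, ih (i + 1) (by omega), face, G.map_comp]
    change G.map _ x = G.map (skipOH i (c + 1) (N - c - 1) N) x
    congr 1
    ext p
    have := p.isLt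
    simp only [skipOH_val, δOH_val, OrderHom.comp_coe, Function.comp_apply]
    split_ifs <;> omega

theorem scomp_eq_map {M : ℕ} (i c : ℕ) (h : i ≤ M) (x : G.obj M) :
    G.scomp i c x = G.map (squashOH i c (M + c) M) x := by
  induction c with
  | zero =>
    conv_lhs => rw [scomp, ← G.map_id x]
    congr 1
    ext p
    have := p.isLt
    simp only [squashOH_val, OrderHom.id_coe, id]
    split_ifs <;> omega
  | succ c ih =>
    rw [scomp, ih, deg, G.map_comp]
    change G.map _ x = G.map (squashOH i (c + 1) (M + c + 1) M) x
    congr 1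
    ext p
    have := p.isLt
    simp only [squashOH_val, σOH_val, Nat.add_eq, OrderHom.comp_coe, Function.comp_apply]
    split_ifs <;> omega

theorem gcast_map {a b N : ℕ} (h : a = b) (α : Fin (a+1) →o Fin (N+1))
    (β : Fin (b+1) →o Fin (N+1))
    (hαβ : ∀ (p : Fin (a+1)) (q : Fin (b+1)), (p:ℕ) = (q:ℕ) → α p = β q) (x : G.obj N) :
    G.gcast b (G.map α x) = G.map β x := by
  subst h
  have : α = β := by
    ext p
    rw [hαβ p p rfl]
  simp [gcast, this]

theorem ds_eq_map {N : ℕ} {i j : ℕ} (hij : i ≤ j) (hj : j ≤ N) (x : G.obj N) :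
    G.ds i j x = G.map (collapseOH N i j) x := by
  rw [ds, min_eq_left (by omega), G.dcomp_eq_map _ _ (by omega),
    G.scomp_eq_map _ _ (by omega), G.map_comp]
  refine G.gcast_map (by omega) _ _ (fun p q hpq => ?_) x
  ext
  have := p.isLt
  simp only [squashOH_val, skipOH_val, collapseOH_val, OrderHom.comp_coe, Function.comp_apply]
  split_ifs <;> omega

theorem map_collapseOH_self {N : ℕ} (i : ℕ) (x : G.obj N) :
    G.map (collapseOH N i i) x = x := by
  conv_rhs => rw [← G.map_id x]
  congr 1
  ext p
  simp only [collapseOH_val, OrderHom.id_coe, id]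
  split_ifs <;> omega

theorem hAux_of_le {n k : ℕ} (g : ℕ → G.obj n) (fuel : ℕ) {i : ℕ} (h : k ≤ i + 1) :
    G.hAux n k g (fuel + 1) i = g i := by
  simp [hAux, h]

theorem hAux_succ {n k : ℕ} (hk : k ≤ n + 1) (g : ℕ → G.obj n) (fuel : ℕ) {i : ℕ}
    (h : i + 1 < k) :
    G.hAux n k g (fuel + 1) i =
      (dProd (fun j => G.map (collapseOH n i j) (G.hAux n k g fuel j)) (i + 1) (k - 1))⁻¹ *
        G.map (collapseOH n i (k - 1)) (dProd g i (k - 1)) := by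
  rw [hAux, if_neg (by omega), G.map_dProd, ← aProd_inv]
  congr 1
  · refine aProd_congr fun j h1 h2 => ?_
    rw [G.ds_eq_map (by omega) (by omega), G.map_inv]
  · refine dProd_congr fun j h1 h2 => ?_
    rw [G.ds_eq_map (by omega) (by omega)]

theorem hAux_unique {n k : ℕ} (hk : k ≤ n + 1) (g z : ℕ → G.obj n)
    (hge : ∀ i, k ≤ i + 1 → z i = g i)
    (hlt : ∀ i, i + 1 < k → dProd (fun j => G.map (collapseOH n i j) (z j)) i (k - 1) =
      G.map (collapseOH n i (k - 1)) (dProd g i (k - 1)))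
    (fuel : ℕ) {i : ℕ} (hfuel : k ≤ fuel + 1 + i) :
    G.hAux n k g (fuel + 1) i = z i := by
  induction fuel generalizing i with
  | zero => rw [G.hAux_of_le g 0 (by omega), hge i (by omega)]
  | succ fuel ih =>
    by_cases h : k ≤ i + 1
    · rw [G.hAux_of_le g _ h, hge i h]
    · rw [G.hAux_succ hk g _ (by omega), inv_mul_eq_iff_eq_mul, ← hlt i (by omega),
        dProd_eq_mul_bottom _ (by omega), G.map_collapseOH_self]
      congr 1
      exact dProd_congr fun j h1 h2 => by rw [ih (by omega)]

theorem hAux_fuel {n k : ℕ} (g : ℕ → G.obj n) (f f' : ℕ) {i : ℕ}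
    (hf : k ≤ f + 1 + i) (hf' : k ≤ f' + 1 + i) :
    G.hAux n k g (f + 1) i = G.hAux n k g (f' + 1) i := by
  induction f generalizing f' i with
  | zero => rw [G.hAux_of_le g _ (by omega), G.hAux_of_le g _ (by omega)]
  | succ f ih =>
    by_cases h : k ≤ i + 1
    · rw [G.hAux_of_le g _ h, G.hAux_of_le g _ h]
    · obtain ⟨f', rfl⟩ : ∃ c, f' = c + 1 := ⟨f' - 1, by omega⟩
      rw [hAux, hAux, if_neg h, if_neg h]
      congr 1
      exact aProd_congr fun j h1 h2 => by rw [ih f' (by omega) (by omega)]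

/-- The defining recursion of the homotopy, solved for the datum it prescribes. -/
theorem dProd_collapse_hAux {n k : ℕ} (hk : k ≤ n + 1) (g : ℕ → G.obj n) (i : ℕ) :
    dProd (fun j => G.map (collapseOH n i j) (G.hAux n k g (n + 1) j)) i (k - 1) =
      G.map (collapseOH n i (k - 1)) (dProd g i (k - 1)) := by
  by_cases h : i + 1 < k
  · rw [dProd_eq_mul_bottom _ (by omega), G.map_collapseOH_self, G.hAux_succ hk g n h,
      ← mul_assoc, mul_eq_right, mul_inv_eq_one]
    refine dProd_congr fun j h1 h2 => ?_
    obtain ⟨f, rfl⟩ : ∃ f, n = f + 1 := ⟨n - 1, by omega⟩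
    rw [G.hAux_fuel g (f + 1) f (by omega) (by omega)]
  · rw [G.map_dProd, dProd_of_le _ (by omega), dProd_of_le _ (by omega)]

theorem xE_diagMap {m n : ℕ} (θ : Fin (m+1) →o Fin (n+1)) (x : Fin n → G.obj n) (j : ℕ) :
    G.xE (G.diagMap θ x) j =
      dProd (fun l => G.map θ (G.xE x l)) (fApp θ j) (fApp θ (j + 1)) := by
  by_cases hj : j < m
  · rw [xE, dif_pos hj, diagMap, ← fApp_coe, ← fApp_coe]
    rfl
  · rw [xE, dif_neg hj, dProd_of_le]
    simp [fApp, show min j m = m by omega, show min (j + 1) m = m by omega]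

end SGrp

theorem kOf_le {n : ℕ} (t : Fin (n+1) →o Fin 2) : kOf t ≤ n + 1 := by
  simpa [kOf] using Finset.card_le_univ (Finset.univ.filter fun i => t i = 0)

theorem lt_kOf_iff {n : ℕ} (t : Fin (n+1) →o Fin 2) (p : Fin (n+1)) :
    (p:ℕ) < kOf t ↔ t p = 0 := by
  constructor
  · intro h
    by_contra hp
    have hsub : (Finset.univ.filter fun i => t i = 0) ⊆ Finset.Iio p := by
      intro q hq
      simp only [Finset.mem_filter, Finset.mem_univ, true_and, Finset.mem_Iio] at hq ⊢
      by_contra hqp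
      have hle := t.monotone (not_lt.mp hqp)
      rw [hq] at hle
      exact hp (Fin.le_zero_iff.mp hle)
    have hcard := Finset.card_le_card hsub
    rw [Fin.card_Iio] at hcard
    exact absurd h (not_lt.mpr hcard)
  · intro h
    have hsub : Finset.Iic p ⊆ Finset.univ.filter fun i => t i = 0 := by
      intro q hq
      simp only [Finset.mem_filter, Finset.mem_univ, true_and, Finset.mem_Iic] at hq ⊢
      have hle := t.monotone hq
      rw [h] at hle
      exact Fin.le_zero_iff.mp hle
    have hcard := Finset.card_le_card hsub
    rw [Fin.card_Iic] at hcard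
    exact hcard

namespace SGrp

variable (G : SGrp)

theorem xE_Hn {n : ℕ} (x : Fin n → G.obj n) (t : Fin (n+1) →o Fin 2) (j : ℕ) :
    G.xE (G.Hn n x t) j = G.hAux n (kOf t) (G.xE x) (n + 1) j := by
  by_cases hj : j < n
  · rw [xE, dif_pos hj, Hn]
  · have := kOf_le t
    rw [G.hAux_of_le _ _ (by omega), xE, xE, dif_neg hj, dif_neg hj]

theorem map_map_congr {l m m' n : ℕ} {α : Fin (l+1) →o Fin (m+1)} {β : Fin (m+1) →o Fin (n+1)}
    {α' : Fin (l+1) →o Fin (m'+1)} {β' : Fin (m'+1) →o Fin (n+1)}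
    (h : ∀ p, (β (α p) : ℕ) = β' (α' p)) (x : G.obj n) :
    G.map α (G.map β x) = G.map α' (G.map β' x) := by
  rw [G.map_comp, G.map_comp]
  congr 1
  ext p
  exact h p

/-- Restriction along `θ` intertwines the collapses of `[m]` and `[n]` whenever the vertices
that `θ` sends to at most `l` are exactly those up to `j`. -/
theorem map_collapse_comm {m n : ℕ} (θ : Fin (m+1) →o Fin (n+1)) {i j l : ℕ} (hij : i ≤ j)
    (hi : i ≤ m) (hjl : ∀ p : Fin (m+1), (θ p : ℕ) ≤ l ↔ (p:ℕ) ≤ j) (x : G.obj n) :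
    G.map (collapseOH m i j) (G.map θ x) = G.map θ (G.map (collapseOH n (fApp θ i) l) x) := by
  refine G.map_map_congr (fun p => ?_) x
  have hl := hjl p
  have hT : fApp θ p = (θ p : ℕ) := fApp_coe θ p
  rw [← fApp_coe θ]
  simp only [collapseOH_val]
  have h1 : (p:ℕ) ≤ i → fApp θ p ≤ fApp θ i := fApp_mono θ
  have h2 : i ≤ (p:ℕ) → fApp θ i ≤ fApp θ p := fApp_mono θ
  rcases le_total (p:ℕ) i with h | h
  · rcases h.eq_or_lt with rfl | hlt <;> split_ifs <;> omega
  · split_ifs <;> omega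

/-- If `θ` has no value in the interval `(fApp θ i, k)`, the products of `y` and `g` over
`[fApp θ i, k-1)` agree after restriction along `θ`. -/
theorem dProd_map_hAux {m n k : ℕ} (hk : k ≤ n + 1) (g : ℕ → G.obj n)
    (θ : Fin (m+1) →o Fin (n+1)) {i : ℕ} (hθ : ∀ p : Fin (m+1), i < (p:ℕ) → k ≤ (θ p : ℕ)) :
    dProd (fun j => G.map θ (G.hAux n k g (n + 1) j)) (fApp θ i) (k - 1) =
      dProd (fun j => G.map θ (g j)) (fApp θ i) (k - 1) := by
  have key : ∀ l, l < k → ∀ x : G.obj n,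
      G.map θ (G.map (collapseOH n (fApp θ i) l) x) = G.map θ x := by
    intro l hl x
    rw [G.map_comp]
    congr 1
    ext p
    have h := hθ p
    have hT : fApp θ p = (θ p : ℕ) := fApp_coe θ p
    have h1 : (p:ℕ) ≤ i → fApp θ p ≤ fApp θ i := fApp_mono θ
    simp only [collapseOH_val, OrderHom.comp_coe, Function.comp_apply]
    split_ifs <;> omega
  have h := congrArg (G.map θ) (G.dProd_collapse_hAux hk g (fApp θ i))
  rw [G.map_dProd, G.map_dProd, G.map_dProd] at h
  calc _ = _ := dProd_congr fun j h1 h2 => (key j (by omega) _).symm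
    _ = _ := h
    _ = _ := dProd_congr fun j h1 h2 => key (k - 1) (by omega) _

/-- Restricting the solution of the recursion along `θ` solves the recursion for the
restricted datum. -/
theorem hAux_restrict {m n k k' : ℕ} (hk : k ≤ n + 1) (hk' : k' ≤ m + 1) (g : ℕ → G.obj n)
    (θ : Fin (m+1) →o Fin (n+1)) (hθ : ∀ p : Fin (m+1), (p:ℕ) < k' ↔ (θ p : ℕ) < k) (i : ℕ) :
    G.hAux m k' (fun j => dProd (fun l => G.map θ (g l)) (fApp θ j) (fApp θ (j + 1))) (m + 1) i =
      dProd (fun l => G.map θ (G.hAux n k g (n + 1) l)) (fApp θ i) (fApp θ (i + 1)) := by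
  have hT : Monotone (fApp θ) := fun _ _ h => fApp_mono θ h
  have hθT : ∀ p, p ≤ m → (p < k' ↔ fApp θ p < k) := by
    intro p hp
    have := hθ ⟨p, by omega⟩
    rwa [← fApp_coe θ] at this
  have hle : ∀ {j l : ℕ}, (j < m → l < fApp θ (j + 1)) → fApp θ j ≤ l →
      ∀ p : Fin (m+1), (θ p : ℕ) ≤ l ↔ (p:ℕ) ≤ j := by
    intro j l h1 h2 p
    rw [← fApp_coe θ]
    constructor
    · intro h
      by_contra hp
      have h3 : fApp θ (j + 1) ≤ fApp θ p := hT (by omega)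
      have := h1 (by omega)
      omega
    · intro h
      exact (hT h).trans h2
  refine G.hAux_unique hk' _ (fun i => dProd (fun l => G.map θ (G.hAux n k g (n + 1) l))
    (fApp θ i) (fApp θ (i + 1))) (fun i hi => ?_) (fun i hi => ?_) m (by omega)
  · have hup : ∀ a b, k - 1 ≤ a → dProd (fun l => G.map θ (G.hAux n k g (n + 1) l)) a b =
        dProd (fun l => G.map θ (g l)) a b := fun a b h =>
      dProd_congr fun j h1 h2 => by rw [G.hAux_of_le g n (by omega)]
    by_cases him : i < m
    · have hki : k ≤ fApp θ (i + 1) := by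
        have := hθT (i + 1) (by omega)
        omega
      by_cases hi1 : k - 1 ≤ fApp θ i
      · exact hup _ _ hi1
      · rw [← dProd_mul_dProd _ (show fApp θ i ≤ k - 1 by omega) (by omega),
          ← dProd_mul_dProd (fun l => G.map θ (g l)) (show fApp θ i ≤ k - 1 by omega) (by omega),
          hup _ _ le_rfl, G.dProd_map_hAux hk g θ]
        intro p hp
        have := hθ p
        omega
    · have : fApp θ (i + 1) = fApp θ i := by
        simp [fApp, show min i m = m by omega, show min (i + 1) m = m by omega]
      rw [dProd_of_le _ this.le, dProd_of_le _ this.le]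
  · obtain ⟨P, rfl⟩ : ∃ P, k' = P + 1 := ⟨k' - 1, by omega⟩
    simp only [Nat.add_sub_cancel]
    have hPk : fApp θ P < k := (hθT P (by omega)).mp (by omega)
    have hiP : fApp θ i ≤ fApp θ P := hT (by omega)
    have hPsucc : P < m → k ≤ fApp θ (P + 1) := fun h => by
      have := hθT (P + 1) (by omega)
      omega
    have hcollapse : ∀ l, fApp θ P ≤ l → l < k → ∀ x : G.obj n,
        G.map (collapseOH m i P) (G.map θ x) =
          G.map θ (G.map (collapseOH n (fApp θ i) l) x) := fun l h1 h2 x =>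
      G.map_collapse_comm θ (by omega) (by omega)
        (hle (fun h => by have := hPsucc h; omega) h1) x
    have hlow : dProd (fun j => G.map (collapseOH m i j) (dProd (fun l =>
          G.map θ (G.hAux n k g (n + 1) l)) (fApp θ j) (fApp θ (j + 1)))) i P =
        dProd (fun l => G.map θ (G.map (collapseOH n (fApp θ i) l) (G.hAux n k g (n + 1) l)))
          (fApp θ i) (fApp θ P) := by
      rw [← dProd_dProd _ hT (show i ≤ P by omega)]
      refine dProd_congr fun j h1 h2 => ?_
      rw [G.map_dProd]
      exact dProd_congr fun l h3 h4 =>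
        G.map_collapse_comm θ h1 (by omega) (hle (fun _ => h4) h3) _
    have hrhs : G.map (collapseOH m i P)
          (dProd (fun l => G.map θ (g l)) (fApp θ i) (fApp θ P)) =
        dProd (fun l => G.map θ (G.map (collapseOH n (fApp θ i) (k - 1)) (g l)))
          (fApp θ i) (fApp θ P) := by
      rw [G.map_dProd]
      exact dProd_congr fun l _ _ => hcollapse (k - 1) (by omega) (by omega) _
    have hhigh : dProd (fun l => G.map θ (G.map (collapseOH n (fApp θ i) l)
          (G.hAux n k g (n + 1) l))) (fApp θ P) (k - 1) =
        dProd (fun l => G.map θ (G.map (collapseOH n (fApp θ i) (k - 1)) (g l)))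
          (fApp θ P) (k - 1) := by
      have h := congrArg (G.map (collapseOH m i P)) (G.dProd_map_hAux hk g θ (i := P)
        fun p hp => by have := hθ p; omega)
      rw [G.map_dProd, G.map_dProd] at h
      calc _ = _ := dProd_congr fun l h1 h2 => (hcollapse l h1 (by omega) _).symm
        _ = _ := h
        _ = _ := dProd_congr fun l h1 h2 => hcollapse (k - 1) (by omega) (by omega) _
    have h := congrArg (G.map θ) (G.dProd_collapse_hAux hk g (fApp θ i))
    rw [G.map_dProd, G.map_dProd, G.map_dProd, ← dProd_mul_dProd _ hiP (by omega),
      ← dProd_mul_dProd (fun l => G.map θ (G.map (collapseOH n (fApp θ i) (k - 1)) (g l)))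
        hiP (by omega), hhigh] at h
    rw [dProd_dProd _ hT (by omega), hlow, hrhs]
    exact mul_left_cancel h

end SGrp

end Paper

open Paper Paper.SGrp in
/-- the maps `H_n : Diag_n NG × Δ^1_n → Diag_n NG` defined via the
elements `y_i^{(n+1-k)}` form a simplicial map `Diag NG × Δ^1 → Diag NG`. -/
theorem stmt_15 (G : SGrp) {m n : ℕ} (θ : Fin (m+1) →o Fin (n+1)) (x : Fin n → G.obj n)
    (t : Fin (n+1) →o Fin 2) :
    G.diagMap θ (G.Hn n x t) = G.Hn m (G.diagMap θ x) (t.comp θ) := by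
  have hk := kOf_le t
  have hk' := kOf_le (t.comp θ)
  have hθ : ∀ p : Fin (m+1), (p:ℕ) < kOf (t.comp θ) ↔ (θ p : ℕ) < kOf t := fun p => by
    rw [lt_kOf_iff, lt_kOf_iff]
    rfl
  funext i
  have h := G.hAux_restrict hk hk' (G.xE x) θ hθ i
  rw [Hn, funext (G.xE_diagMap θ x), h]
  simp only [← G.xE_Hn]
  rw [← G.xE_diagMap, xE, dif_pos i.isLt]
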